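/- Let d ≥ 2, let π⁰ be a probability vector on [d], and let 0 < Δ ≤ 1. Then for every estimator π̂ : [d]^n → ℝ^d there exists a probability vector π ∈ B(π⁰, Δ) with E[‖π − π̂(X^n)‖²] ≥ ((1 − ‖π⁰‖²)/(d − 1)) · min( Δ²/12, 1/(4n) ). -/

import Mathlib

open Finset

/-- `π` is a probability vector on `Fin d`: nonnegative coordinates summing to 1. -/
def IsProbVec {d : ℕ} (π : Fin d → ℝ) : Prop :=
  (∀ i, 0 ≤ π i) ∧ ∑ i, π i = 1

/-- Probability of observing the sample sequence `x` under i.i.d. draws from `π`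
(the `n`-fold product law of `π`). -/
noncomputable def prodProb {d n : ℕ} (π : Fin d → ℝ) (x : Fin n → Fin d) : ℝ :=
  ∏ k, π (x k)

/-- Expectation of `f (X^n)` where `X^n = (X_1,…,X_n)` are i.i.d. samples from `π`. -/
noncomputable def expect {d n : ℕ} (π : Fin d → ℝ) (f : (Fin n → Fin d) → ℝ) : ℝ :=
  ∑ x : Fin n → Fin d, prodProb π x * f x

/-- `N_i`: the number of occurrences of symbol `i` in the sample `x`. -/
def cnt {d n : ℕ} (x : Fin n → Fin d) (i : Fin d) : ℕ :=
  (Finset.univ.filter (fun k => x k = i)).card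

/-- The empirical estimator `π^em(x) i = N_i / n`. -/
noncomputable def empDist {d n : ℕ} (x : Fin n → Fin d) : Fin d → ℝ :=
  fun i => (cnt x i : ℝ) / n

/-- Squared Euclidean (ℓ2) distance `‖u - v‖²`. -/
noncomputable def sqDist {d : ℕ} (u v : Fin d → ℝ) : ℝ := ∑ i, (u i - v i) ^ 2

/-- Euclidean (ℓ2) norm. -/
noncomputable def l2norm {d : ℕ} (u : Fin d → ℝ) : ℝ := Real.sqrt (∑ i, u i ^ 2)

lemma aux_cs {X : Type*} [Fintype X] {d : ℕ} (P Q : X → ℝ) (hP : ∀ x, 0 ≤ P x) (hQ : ∀ x, 0 ≤ Q x)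
    (hP1 : ∑ x, P x = 1) (hQ1 : ∑ x, Q x = 1) (u w : Fin d → ℝ) (e : X → Fin d → ℝ) :
    sqDist u w * (∑ x, √(P x * Q x)) ^ 2 ≤
      2 * (∑ x, P x * sqDist u (e x) + ∑ x, Q x * sqDist w (e x)) := by
  have hS : ∀ a b : Fin d → ℝ, 0 ≤ sqDist a b := fun a b => Finset.sum_nonneg fun i _ => sq_nonneg _
  have key : (∑ x, √(sqDist u w) * √(P x * Q x)) ^ 2 ≤
      (∑ x, (P x * sqDist u (e x) + Q x * sqDist w (e x))) * ∑ x, (P x + Q x) := by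
    apply Finset.sum_sq_le_sum_mul_sum_of_sq_le_mul
    · intro x _
      exact add_nonneg (mul_nonneg (hP x) (hS _ _)) (mul_nonneg (hQ x) (hS _ _))
    · intro x _
      exact add_nonneg (hP x) (hQ x)
    · intro x _
      rw [mul_pow, Real.sq_sqrt (hS _ _), Real.sq_sqrt (mul_nonneg (hP x) (hQ x))]
      unfold sqDist
      rw [Finset.mul_sum, Finset.mul_sum, ← Finset.sum_add_distrib, Finset.sum_mul, Finset.sum_mul]
      apply Finset.sum_le_sum
      intro i _
      nlinarith [sq_nonneg (P x * (u i - e x i) + Q x * (w i - e x i))]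
  rw [← Finset.mul_sum, mul_pow, Real.sq_sqrt (hS _ _), Finset.sum_add_distrib,
    Finset.sum_add_distrib, hP1, hQ1] at key
  linarith

lemma aux_lecam {d n : ℕ} (u w : Fin d → ℝ) (hu : IsProbVec u) (hw : IsProbVec w)
    (est : (Fin n → Fin d) → (Fin d → ℝ)) :
    sqDist u w * ((∑ i, √(u i * w i)) ^ 2) ^ n ≤
      2 * (expect u (fun x => sqDist u (est x)) + expect w (fun x => sqDist w (est x))) := by
  have h := aux_cs (prodProb (n := n) u) (prodProb (n := n) w)
    (fun x => Finset.prod_nonneg fun k _ => hu.1 _) (fun x => Finset.prod_nonneg fun k _ => hw.1 _)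
    (by unfold prodProb; rw [← Fintype.sum_pow, hu.2, one_pow])
    (by unfold prodProb; rw [← Fintype.sum_pow, hw.2, one_pow]) u w est
  have e : ∑ x : Fin n → Fin d, √(prodProb u x * prodProb w x) = (∑ i, √(u i * w i)) ^ n := by
    rw [Fintype.sum_pow]
    refine Finset.sum_congr rfl fun x _ => ?_
    unfold prodProb
    rw [← Finset.prod_mul_distrib, Real.sqrt_prod]
    intro k _
    exact mul_nonneg (hu.1 _) (hw.1 _)
  rw [e, pow_right_comm] at h
  exact h

/-- the one-parameter family -/
noncomputable def fam {d : ℕ} (j : Fin d) (ρ : Fin d → ℝ) (t : ℝ) : Fin d → ℝ :=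
  fun i => if i = j then t else (1 - t) * ρ i

lemma sum_ite_split {d : ℕ} (j : Fin d) (ρ : Fin d → ℝ) (hj : ρ j = 0) (a c : ℝ) :
    ∑ i, (if i = j then a else c * ρ i) = a + c * ∑ i, ρ i := by
  have : ∀ i, (if i = j then a else c * ρ i) = (if i = j then a else 0) + c * ρ i := by
    intro i
    split_ifs with h
    · subst h; simp [hj]
    · simp
  simp_rw [this]
  rw [Finset.sum_add_distrib, ← Finset.mul_sum]
  simp

lemma fam_prob {d : ℕ} (j : Fin d) (ρ : Fin d → ℝ) (hj : ρ j = 0) (hρ : IsProbVec ρ) (t : ℝ)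
    (h0 : 0 ≤ t) (h1 : t ≤ 1) : IsProbVec (fam j ρ t) := by
  constructor
  · intro i
    unfold fam
    split_ifs
    · exact h0
    · exact mul_nonneg (by linarith) (hρ.1 i)
  · unfold fam
    rw [sum_ite_split j ρ hj, hρ.2]; ring

lemma fam_dist {d : ℕ} (j : Fin d) (ρ : Fin d → ℝ) (hj : ρ j = 0) (a b : ℝ) :
    ∑ i, (fam j ρ a i - fam j ρ b i) ^ 2 = (a - b) ^ 2 * (1 + ∑ i, ρ i ^ 2) := by
  have : ∀ i, (fam j ρ a i - fam j ρ b i) ^ 2 =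
      if i = j then (a - b) ^ 2 else (a - b) ^ 2 * (fun i => ρ i ^ 2) i := by
    intro i
    unfold fam
    split_ifs <;> ring
  simp_rw [this]
  rw [sum_ite_split j (fun i => ρ i ^ 2) (by simp [hj])]; ring

lemma fam_aff {d : ℕ} (j : Fin d) (ρ : Fin d → ℝ) (hj : ρ j = 0) (hρ : IsProbVec ρ) (a b : ℝ)
    (ha1 : a ≤ 1) (hb1 : b ≤ 1) :
    ∑ i, √(fam j ρ a i * fam j ρ b i) = √(a * b) + √((1 - a) * (1 - b)) := by
  have : ∀ i, √(fam j ρ a i * fam j ρ b i) =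
      if i = j then √(a * b) else √((1 - a) * (1 - b)) * ρ i := by
    intro i
    unfold fam
    split_ifs
    · rfl
    · rw [show (1 - a) * ρ i * ((1 - b) * ρ i) = ((1 - a) * (1 - b)) * ρ i ^ 2 by ring,
        Real.sqrt_mul (mul_nonneg (by linarith) (by linarith)), Real.sqrt_sq (hρ.1 i)]
  simp_rw [this]
  rw [sum_ite_split j ρ hj, hρ.2, mul_one]

/-- two points with arcsine midpoint `1/2 + σ` -/
lemma aux_aff (σ g c S : ℝ) (h1 : σ ^ 2 + g ^ 2 = 1 / 4) (h2 : c ^ 2 + S ^ 2 = 1)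
    (a b : ℝ) (ha : a = 1 / 2 + σ * c + g * S) (hb : b = 1 / 2 + σ * c - g * S)
    (ha0 : 0 ≤ a) (ha1 : a ≤ 1) (hb0 : 0 ≤ b) (hb1 : b ≤ 1) :
    1 - S ^ 2 ≤ (√(a * b) + √((1 - a) * (1 - b))) ^ 2 := by
  have hA : 0 ≤ a * b := mul_nonneg ha0 hb0
  have hB : 0 ≤ (1 - a) * (1 - b) := mul_nonneg (by linarith) (by linarith)
  rw [add_sq, Real.sq_sqrt hA, Real.sq_sqrt hB, mul_assoc, ← Real.sqrt_mul hA]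
  have : g ^ 2 * c ^ 2 - σ ^ 2 * S ^ 2 ≤ √(a * b * ((1 - a) * (1 - b))) := by
    apply Real.le_sqrt_of_sq_le
    apply le_of_eq
    have e1 : a * (1 - a) = (g * c - σ * S) ^ 2 := by
      subst ha; linear_combination (-1 / 4 : ℝ) * h2 + (-c ^ 2 - S ^ 2) * h1
    have e2 : b * (1 - b) = (g * c + σ * S) ^ 2 := by
      subst hb; linear_combination (-1 / 4 : ℝ) * h2 + (-c ^ 2 - S ^ 2) * h1
    calc _ = (g * c - σ * S) ^ 2 * (g * c + σ * S) ^ 2 := by ring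
      _ = _ := by rw [← e1, ← e2]; ring
  have e3 : a * b + (1 - a) * (1 - b) = 1 / 2 + 2 * (σ ^ 2 * c ^ 2 - g ^ 2 * S ^ 2) := by
    subst ha hb; ring
  have e4 : 1 / 2 + 2 * (σ ^ 2 * c ^ 2 - g ^ 2 * S ^ 2) + 2 * (g ^ 2 * c ^ 2 - σ ^ 2 * S ^ 2)
      = 1 - S ^ 2 := by
    linear_combination 2 * (c ^ 2 - S ^ 2) * h1 + (1 / 2 : ℝ) * h2
  linarith

lemma aux_range (σ g c S : ℝ) (h1 : σ ^ 2 + g ^ 2 = 1 / 4) (h2 : c ^ 2 + S ^ 2 = 1) :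
    0 ≤ 1 / 2 + σ * c + g * S ∧ 1 / 2 + σ * c + g * S ≤ 1 := by
  have : (σ * c + g * S) ^ 2 ≤ (1 / 2) ^ 2 := by
    have : (σ * c + g * S) ^ 2 + (σ * S - g * c) ^ 2 = 1 / 4 := by
      linear_combination (c ^ 2 + S ^ 2) * h1 + (1 / 4 : ℝ) * h2
    nlinarith [sq_nonneg (σ * S - g * c)]
  have := abs_le_of_sq_le_sq' this (by norm_num)
  constructor <;> linarith [this.1, this.2]

lemma aux_ball (σ g c S : ℝ) (h1 : σ ^ 2 + g ^ 2 = 1 / 4) (h2 : c ^ 2 + S ^ 2 = 1) (hc : 0 ≤ c) :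
    (1 / 2 + σ * c + g * S - (1 / 2 + σ)) ^ 2 ≤ S ^ 2 / 2 := by
  have e : (1 / 2 + σ * c + g * S - (1 / 2 + σ)) ^ 2 + (σ * S + g * (1 - c)) ^ 2 = (1 - c) / 2 := by
    linear_combination ((1 - c) ^ 2 + S ^ 2) * h1 + (1 / 4 : ℝ) * h2
  have hc1 : c ≤ 1 := by nlinarith [sq_nonneg S]
  nlinarith [sq_nonneg (σ * S + g * (1 - c)), mul_nonneg hc (sub_nonneg.2 hc1)]

lemma aux_final (p r D : ℝ) (hp1 : p ≤ 1) (hD : 1 ≤ D) (hr : 1 ≤ D * r)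
    (hp : 1 ≤ (D + 1) * p) :
    (1 - (p ^ 2 + (1 - p) ^ 2 * r)) / D ≤ p * (1 - p) * (1 + r) := by
  have hD0 : 0 < D := by linarith
  have hp0 : 0 ≤ p := by nlinarith
  rw [div_le_iff₀ hD0]
  have h1 : 0 ≤ r * (p * D + 1 - p) + p * (D - 1) - 1 := by
    have : 0 ≤ D * (r * (p * D + 1 - p) + p * (D - 1) - 1) := by
      have h3 : 0 ≤ p * D + 1 - p := by nlinarith
      nlinarith [mul_nonneg (sub_nonneg.2 hr) h3, mul_nonneg (sub_nonneg.2 hD) (sub_nonneg.2 hp)]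
    exact nonneg_of_mul_nonneg_right this hD0
  nlinarith [mul_nonneg (sub_nonneg.2 hp1) h1]

/-- Minimax lower bound for general π⁰: for every estimator there is a
π ∈ B(π⁰,Δ) whose risk is at least ((1 − ‖π⁰‖²)/(d−1))·min(Δ²/12, 1/(4n)). -/
theorem stmt_13 {d n : ℕ} (hd : 2 ≤ d) (hn : 1 ≤ n)
    (π0 : Fin d → ℝ) (hπ0 : IsProbVec π0)
    (Δ : ℝ) (hΔpos : 0 < Δ) (hΔle : Δ ≤ 1)
    (est : (Fin n → Fin d) → (Fin d → ℝ)) :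
    ∃ π : Fin d → ℝ, IsProbVec π ∧ l2norm (fun i => π i - π0 i) ≤ Δ ∧
      (1 - ∑ i, π0 i ^ 2) / ((d : ℝ) - 1) * min (Δ ^ 2 / 12) (1 / (4 * (n : ℝ))) ≤
        expect π (fun x : Fin n → Fin d => sqDist π (est x)) := by
  have hd' : (2 : ℝ) ≤ d := by exact_mod_cast hd
  have hn' : (1 : ℝ) ≤ n := by exact_mod_cast hn
  haveI : Nonempty (Fin d) := ⟨⟨0, by omega⟩⟩
  obtain ⟨j, hjmax⟩ := Finite.exists_max π0
  set p := π0 j with hp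
  have hp0 : 0 ≤ p := hπ0.1 j
  have hsplit : p + ∑ i ∈ univ.erase j, π0 i = 1 := by
    rw [hp, Finset.add_sum_erase _ _ (mem_univ j), hπ0.2]
  have hp1 : p ≤ 1 := by
    have : 0 ≤ ∑ i ∈ univ.erase j, π0 i := Finset.sum_nonneg fun i _ => hπ0.1 i
    linarith
  have hdp : 1 ≤ d * p := by
    calc (1 : ℝ) = ∑ i, π0 i := hπ0.2.symm
      _ ≤ ∑ i : Fin d, p := Finset.sum_le_sum fun i _ => hjmax i
      _ = d * p := by simp
  set m := min (Δ ^ 2 / 12) (1 / (4 * (n : ℝ))) with hm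
  have hm0 : 0 < m := by rw [hm]; positivity
  rcases hp1.eq_or_lt with h | hlt
  · refine ⟨π0, hπ0, ?_, ?_⟩
    · simp [l2norm, hΔpos.le]
    · have h1 : 1 ≤ ∑ i, π0 i ^ 2 := by
        have := Finset.single_le_sum (f := fun i => π0 i ^ 2) (fun i _ => sq_nonneg _) (mem_univ j)
        simp only [← hp, h] at this
        linarith
      have h2 : 0 ≤ expect π0 (fun x : Fin n → Fin d => sqDist π0 (est x)) :=
        Finset.sum_nonneg fun x _ => mul_nonneg (Finset.prod_nonneg fun k _ => hπ0.1 _)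
          (Finset.sum_nonneg fun i _ => sq_nonneg _)
      refine le_trans (mul_nonpos_of_nonpos_of_nonneg ?_ hm0.le) h2
      exact div_nonpos_of_nonpos_of_nonneg (by linarith) (by linarith)
  have hq : 0 < 1 - p := by linarith
  set ρ : Fin d → ℝ := fun i => if i = j then 0 else π0 i / (1 - p) with hρdef
  have hρj : ρ j = 0 := by simp [hρdef]
  have hρe : ∀ i, i ≠ j → ρ i = π0 i / (1 - p) := fun i hi => by simp [hρdef, hi]
  have hρ0 : ∀ i, 0 ≤ ρ i := by
    intro i
    by_cases hi : i = j
    · rw [hi, hρj]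
    · rw [hρe i hi]; exact div_nonneg (hπ0.1 i) hq.le
  have hρer : ∑ i ∈ univ.erase j, ρ i = 1 := by
    rw [Finset.sum_congr rfl fun i hi => hρe i (Finset.ne_of_mem_erase hi), ← Finset.sum_div,
      div_eq_one_iff_eq hq.ne']
    linarith
  have hρ1 : ∑ i, ρ i = 1 := by
    rw [← Finset.add_sum_erase _ _ (mem_univ j), hρj, hρer, zero_add]
  have hρ : IsProbVec ρ := ⟨hρ0, hρ1⟩
  have hfam : π0 = fam j ρ p := by
    funext i
    unfold fam
    split_ifs with hi
    · rw [hi]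
    · rw [hρe i hi]; field_simp
  set r := ∑ i, ρ i ^ 2 with hr
  have hrD : 1 ≤ ((d : ℝ) - 1) * r := by
    have h := sq_sum_le_card_mul_sum_sq (s := univ.erase j) (f := ρ)
    rw [hρer, Finset.card_erase_of_mem (mem_univ j), Finset.card_univ, Fintype.card_fin,
      Nat.cast_sub (by omega)] at h
    have : r = ∑ i ∈ univ.erase j, ρ i ^ 2 := by
      rw [hr, ← Finset.add_sum_erase _ _ (mem_univ j), hρj]; simp
    rw [this]
    simpa using h
  have hr1 : r ≤ 1 := by
    rw [← hρ1]
    refine Finset.sum_le_sum fun i _ => ?_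
    have : ρ i ≤ 1 := by
      rw [← hρ1]; exact Finset.single_le_sum (fun i _ => hρ0 i) (mem_univ i)
    nlinarith [hρ0 i]
  have hr0 : 0 ≤ r := Finset.sum_nonneg fun i _ => sq_nonneg _
  have hnorm : ∑ i, π0 i ^ 2 = p ^ 2 + (1 - p) ^ 2 * r := by
    rw [hfam]
    have : ∀ i, fam j ρ p i ^ 2 = if i = j then p ^ 2 else (1 - p) ^ 2 * (fun i => ρ i ^ 2) i := by
      intro i
      unfold fam
      split_ifs <;> ring
    simp_rw [this]
    rw [sum_ite_split j (fun i => ρ i ^ 2) (by simp [hρj])]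
  have hfin := aux_final p r ((d : ℝ) - 1) hp1 (by linarith) hrD (by linarith)
  rw [← hnorm] at hfin
  -- parameters
  have hmΔ : m ≤ Δ ^ 2 / 12 := min_le_left _ _
  have hmn : m * n ≤ 1 / 4 := by
    have : m ≤ 1 / (4 * (n : ℝ)) := min_le_right _ _
    rw [le_div_iff₀ (by linarith)] at this
    linarith
  have hm12 : m ≤ 1 / 12 := by nlinarith
  set S := √(2 * m)
  set c := √(1 - 2 * m)
  set g := √(p * (1 - p))
  have hS : S ^ 2 = 2 * m := Real.sq_sqrt (by linarith)
  have hc : c ^ 2 = 1 - 2 * m := Real.sq_sqrt (by linarith)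
  have hg : g ^ 2 = p * (1 - p) := Real.sq_sqrt (mul_nonneg hp0 hq.le)
  have hc0 : 0 ≤ c := Real.sqrt_nonneg _
  obtain ⟨σ, hσ⟩ : ∃ σ, σ = p - 1 / 2 := ⟨_, rfl⟩
  have h1 : σ ^ 2 + g ^ 2 = 1 / 4 := by rw [hg, hσ]; ring
  have h2 : c ^ 2 + S ^ 2 = 1 := by rw [hc, hS]; ring
  have h1' : σ ^ 2 + (-g) ^ 2 = 1 / 4 := by rw [neg_sq, h1]
  obtain ⟨ha0, ha1⟩ := aux_range σ g c S h1 h2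
  obtain ⟨hb0, hb1⟩ := aux_range σ (-g) c S h1' h2
  have hba := aux_ball σ g c S h1 h2 hc0
  have hbb := aux_ball σ (-g) c S h1' h2 hc0
  obtain ⟨a, ha⟩ : ∃ a, a = 1 / 2 + σ * c + g * S := ⟨_, rfl⟩
  obtain ⟨b, hb⟩ : ∃ b, b = 1 / 2 + σ * c + (-g) * S := ⟨_, rfl⟩
  rw [← ha] at ha0 ha1 hba
  rw [← hb] at hb0 hb1 hbb
  rw [show 1 / 2 + σ = p by rw [hσ]; ring, hS] at hba hbb
  have haff := aux_aff σ g c S h1 h2 a b ha (by rw [hb]; ring) ha0 ha1 hb0 hb1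
  rw [hS] at haff
  have hball : ∀ t : ℝ, (t - p) ^ 2 ≤ 2 * m / 2 → l2norm (fun i => fam j ρ t i - π0 i) ≤ Δ := by
    intro t ht
    unfold l2norm
    apply Real.sqrt_le_iff.2 ⟨hΔpos.le, ?_⟩
    rw [hfam, fam_dist j ρ hρj, ← hr]
    nlinarith [sq_nonneg (t - p), sq_nonneg Δ]
  have hpa := fam_prob j ρ hρj hρ a ha0 ha1
  have hpb := fam_prob j ρ hρj hρ b hb0 hb1
  have hlc := aux_lecam (n := n) _ _ hpa hpb est
  rw [fam_aff j ρ hρj hρ a b ha1 hb1] at hlc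
  have hsd : sqDist (fam j ρ a) (fam j ρ b) = 8 * m * (p * (1 - p) * (1 + r)) := by
    unfold sqDist
    rw [fam_dist j ρ hρj, ← hr, show a - b = 2 * g * S by rw [ha, hb]; ring, mul_pow, mul_pow,
      hg, hS]
    ring
  have hpow : 1 / 2 ≤ ((√(a * b) + √((1 - a) * (1 - b))) ^ 2) ^ n := by
    have hb := one_add_mul_le_pow (a := -(2 * m)) (by linarith) n
    have := pow_le_pow_left₀ (by linarith) haff n
    have e : (1 + -(2 * m)) = 1 - 2 * m := by ring
    rw [e] at hb
    linarith
  rw [hsd] at hlc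
  set V := p * (1 - p) * (1 + r)
  have hV0 : 0 ≤ V := mul_nonneg (mul_nonneg hp0 hq.le) (by linarith)
  have hlc2 : 8 * m * V * (1 / 2) ≤ _ := le_trans (mul_le_mul_of_nonneg_left hpow
    (mul_nonneg (by linarith) hV0)) hlc
  have hgoal := mul_le_mul_of_nonneg_right hfin hm0.le
  by_cases hcase : V * m ≤ expect (fam j ρ a) (fun x : Fin n → Fin d => sqDist (fam j ρ a) (est x))
  · exact ⟨_, hpa, hball a hba, hgoal.trans hcase⟩
  · refine ⟨_, hpb, hball b hbb, hgoal.trans ?_⟩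
    push Not at hcase
    linarith
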